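/- (Robert's theorem.) Let d ≥ 2, let m be a natural number and let a ∈ ℂ[t, x_1, …, x_d] satisfy D1(a) = 0, (D1∘D2 − D2∘D1)(a) = m·a, and D2^{m+1}(a) = 0. In the polynomial ring ℂ[t, x_1, …, x_d][Y_1, Y_2] set F = Σ_{i=0}^{m} (1/i!)·D2^i(a)·Y_1^{m−i}·Y_2^i. Then F satisfies the two covariance equations D1(F) = Y_2·∂F/∂Y_1 and D2(F) = Y_1·∂F/∂Y_2, where D1 and D2 act on F coefficientwise (i.e. as the derivations of ℂ[t, x_1, …, x_d][Y_1, Y_2] extending D1, resp. D2, and annihilating Y_1 and Y_2). -/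

import Mathlib

open MvPolynomial Finset

/-- The derivation `D1 = t·∂/∂x₁ + 2x₁·∂/∂x₂ + ⋯ + d·x_{d−1}·∂/∂x_d` on
`ℂ[t, x₁, …, x_d]`, where the variable of index `0` is `t` and the variable of
index `j ≥ 1` is `x_j`. -/
noncomputable def D1 (d : ℕ) :
    Derivation ℂ (MvPolynomial (Fin (d + 1)) ℂ) (MvPolynomial (Fin (d + 1)) ℂ) :=
  MvPolynomial.mkDerivation ℂ (fun i =>
    if (i : ℕ) = 0 then 0
    else ((i : ℕ) : ℂ) •
      MvPolynomial.X (⟨(i : ℕ) - 1, lt_of_le_of_lt (Nat.sub_le _ _) i.isLt⟩ : Fin (d + 1)))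

/-- The derivation `D2 = d·x₁·∂/∂t + (d−1)·x₂·∂/∂x₁ + ⋯ + x_d·∂/∂x_{d−1}` on
`ℂ[t, x₁, …, x_d]`, where the variable of index `0` is `t` and the variable of
index `j ≥ 1` is `x_j`. -/
noncomputable def D2 (d : ℕ) :
    Derivation ℂ (MvPolynomial (Fin (d + 1)) ℂ) (MvPolynomial (Fin (d + 1)) ℂ) :=
  MvPolynomial.mkDerivation ℂ (fun i =>
    if h : (i : ℕ) < d then
      ((d - (i : ℕ) : ℕ) : ℂ) • MvPolynomial.X (⟨(i : ℕ) + 1, by omega⟩ : Fin (d + 1))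
    else 0)

/-- The first of the two extra variables `Y₁, Y₂` of `ℂ[t, x₁, …, x_d][Y₁, Y₂]`,
the latter ring being modelled as `MvPolynomial (Fin (d+1) ⊕ Fin 2) ℂ`. -/
noncomputable def Y1 (d : ℕ) : MvPolynomial (Fin (d + 1) ⊕ Fin 2) ℂ :=
  MvPolynomial.X (Sum.inr 0)

/-- The second extra variable `Y₂`. -/
noncomputable def Y2 (d : ℕ) : MvPolynomial (Fin (d + 1) ⊕ Fin 2) ℂ :=
  MvPolynomial.X (Sum.inr 1)

/-- The extension of `D1` to `ℂ[t, x₁, …, x_d][Y₁, Y₂]` acting coefficientwise,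
i.e. agreeing with `D1` on the variables `t, x₁, …, x_d` and annihilating `Y₁, Y₂`. -/
noncomputable def D1Y (d : ℕ) :
    Derivation ℂ (MvPolynomial (Fin (d + 1) ⊕ Fin 2) ℂ)
      (MvPolynomial (Fin (d + 1) ⊕ Fin 2) ℂ) :=
  MvPolynomial.mkDerivation ℂ
    (Sum.elim (fun i => MvPolynomial.rename Sum.inl (D1 d (MvPolynomial.X i))) (fun _ => 0))

/-- The extension of `D2` to `ℂ[t, x₁, …, x_d][Y₁, Y₂]` acting coefficientwise. -/
noncomputable def D2Y (d : ℕ) :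
    Derivation ℂ (MvPolynomial (Fin (d + 1) ⊕ Fin 2) ℂ)
      (MvPolynomial (Fin (d + 1) ⊕ Fin 2) ℂ) :=
  MvPolynomial.mkDerivation ℂ
    (Sum.elim (fun i => MvPolynomial.rename Sum.inl (D2 d (MvPolynomial.X i))) (fun _ => 0))


lemma H_X (d : ℕ) (i : Fin (d+1)) :
    ⁅D1 d, D2 d⁆ (X i) = ((d : ℂ) - 2 * (i : ℕ)) • X i := by
  obtain ⟨i, hi⟩ := i
  rw [Derivation.commutator_apply]
  have e1 : D1 d (D2 d (X ⟨i, hi⟩)) = (((d : ℂ) - i) * (i + 1)) • X ⟨i, hi⟩ := by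
    by_cases h : i < d
    · simp [D1, D2, mkDerivation_X, h, smul_smul, Nat.cast_sub h.le]
    · have : i = d := by omega
      subst this
      simp [D2, mkDerivation_X]
  have e2 : D2 d (D1 d (X ⟨i, hi⟩)) = ((i : ℂ) * (d - i + 1)) • X ⟨i, hi⟩ := by
    rcases i with _ | i
    · simp [D1, mkDerivation_X]
    · have h : i < d := by omega
      simp [D1, D2, mkDerivation_X, h, smul_smul, Nat.cast_sub h.le]
      left
      ring
  rw [e1, e2, ← sub_smul]
  congr 1
  simp only
  ring

lemma HD2 (d : ℕ) : ⁅⁅D1 d, D2 d⁆, D2 d⁆ = (-2 : ℂ) • D2 d := by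
  apply MvPolynomial.derivation_ext
  intro i
  rw [Derivation.commutator_apply, H_X, Derivation.map_smul, Derivation.smul_apply]
  obtain ⟨i, hi⟩ := i
  by_cases h : i < d
  · have : D2 d (X ⟨i, hi⟩) = ((d - i : ℕ) : ℂ) • X (⟨i + 1, by omega⟩ : Fin (d + 1)) := by
      simp [D2, mkDerivation_X, h]
    rw [this, Derivation.map_smul, H_X, smul_smul, smul_smul, smul_smul, ← sub_smul]
    congr 1
    push_cast
    ring
  · have : D2 d (X ⟨i, hi⟩) = 0 := by
      simp [D2, mkDerivation_X, h]
    simp [this]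

lemma H_iter (d m : ℕ) (a : MvPolynomial (Fin (d + 1)) ℂ)
    (h : ⁅D1 d, D2 d⁆ a = (m : ℂ) • a) (i : ℕ) :
    ⁅D1 d, D2 d⁆ ((⇑(D2 d))^[i] a) = ((m : ℂ) - 2 * i) • (⇑(D2 d))^[i] a := by
  induction i with
  | zero => simpa using h
  | succ i ih =>
    rw [Function.iterate_succ_apply']
    have : ⁅⁅D1 d, D2 d⁆, D2 d⁆ ((⇑(D2 d))^[i] a) = ((-2 : ℂ) • D2 d) ((⇑(D2 d))^[i] a) := by
      rw [HD2]
    rw [Derivation.commutator_apply, ih, Derivation.map_smul, Derivation.smul_apply,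
      sub_eq_iff_eq_add] at this
    rw [this, ← add_smul]
    congr 1
    push_cast
    ring

lemma D1_iter (d m : ℕ) (a : MvPolynomial (Fin (d + 1)) ℂ) (h1 : D1 d a = 0)
    (h : ⁅D1 d, D2 d⁆ a = (m : ℂ) • a) (i : ℕ) :
    D1 d ((⇑(D2 d))^[i + 1] a) = (((i : ℂ) + 1) * (m - i)) • (⇑(D2 d))^[i] a := by
  have key : ∀ i, D1 d ((⇑(D2 d))^[i + 1] a) =
      D2 d (D1 d ((⇑(D2 d))^[i] a)) + ((m : ℂ) - 2 * i) • (⇑(D2 d))^[i] a := by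
    intro i
    have := H_iter d m a h i
    rw [Derivation.commutator_apply, sub_eq_iff_eq_add] at this
    rw [Function.iterate_succ_apply', this]
    exact add_comm _ _
  induction i with
  | zero => rw [key]; simp [h1]
  | succ i ih =>
    rw [key, ih, Derivation.map_smul, ← Function.iterate_succ_apply' (D2 d), ← add_smul]
    congr 1
    push_cast
    ring

lemma ext_rename {σ τ : Type*} (D : Derivation ℂ (MvPolynomial σ ℂ) (MvPolynomial σ ℂ))
    (E : Derivation ℂ (MvPolynomial τ ℂ) (MvPolynomial τ ℂ)) (f : σ → τ)
    (h : ∀ i, E (X (f i)) = rename f (D (X i))) (p : MvPolynomial σ ℂ) :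
    E (rename f p) = rename f (D p) := by
  induction p using MvPolynomial.induction_on with
  | C r => simp [MvPolynomial.derivation_C]
  | add p q hp hq => simp [hp, hq]
  | mul_X p i hp => simp [hp, h, Derivation.leibniz]

lemma D1Y_rename (d : ℕ) (p) : D1Y d (rename Sum.inl p) = rename Sum.inl (D1 d p) :=
  ext_rename _ _ _ (fun i => by simp [D1Y, mkDerivation_X]) p

lemma D2Y_rename (d : ℕ) (p) : D2Y d (rename Sum.inl p) = rename Sum.inl (D2 d p) :=
  ext_rename _ _ _ (fun i => by simp [D2Y, mkDerivation_X]) p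

lemma pd_rename (d : ℕ) (j : Fin 2) (p : MvPolynomial (Fin (d+1)) ℂ) :
    pderiv (Sum.inr j) (rename Sum.inl p : MvPolynomial (Fin (d+1) ⊕ Fin 2) ℂ) = 0 := by
  rw [ext_rename 0 _ Sum.inl (fun i => by simp [pderiv_X]) p]; simp

/-- **Robert's theorem.**  If `a` is a semi-invariant (`D1(a) = 0`) of weight `m`
(`(D1∘D2 − D2∘D1)(a) = m·a`) with `D2^{m+1}(a) = 0`, then
`F = Σ_{i=0}^{m} (1/i!)·D2^i(a)·Y₁^{m−i}·Y₂^i` satisfies the two covariance equations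
`D1(F) = Y₂·∂F/∂Y₁` and `D2(F) = Y₁·∂F/∂Y₂`. -/
theorem roberts_theorem (d : ℕ) (hd : 2 ≤ d) (m : ℕ) (a : MvPolynomial (Fin (d + 1)) ℂ)
    (ha1 : D1 d a = 0)
    (ha2 : D1 d (D2 d a) - D2 d (D1 d a) = (m : ℂ) • a)
    (ha3 : (⇑(D2 d))^[m + 1] a = 0)
    (F : MvPolynomial (Fin (d + 1) ⊕ Fin 2) ℂ)
    (hF : F = ∑ i ∈ Finset.range (m + 1),
      ((1 : ℂ) / (i.factorial : ℂ)) •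
        (MvPolynomial.rename Sum.inl ((⇑(D2 d))^[i] a) * (Y1 d) ^ (m - i) * (Y2 d) ^ i)) :
    D1Y d F = Y2 d * MvPolynomial.pderiv (Sum.inr 0) F ∧
    D2Y d F = Y1 d * MvPolynomial.pderiv (Sum.inr 1) F := by
  have hH : ⁅D1 d, D2 d⁆ a = (m : ℂ) • a := by rw [Derivation.commutator_apply, ha2]
  have a1 : D1Y d (Y1 d) = 0 := by simp [D1Y, Y1, mkDerivation_X]
  have a2 : D1Y d (Y2 d) = 0 := by simp [D1Y, Y2, mkDerivation_X]
  have b1 : D2Y d (Y1 d) = 0 := by simp [D2Y, Y1, mkDerivation_X]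
  have b2 : D2Y d (Y2 d) = 0 := by simp [D2Y, Y2, mkDerivation_X]
  have c1 : pderiv (Sum.inr 0) (Y1 d) = 1 := by simp [Y1]
  have c2 : pderiv (Sum.inr 0) (Y2 d) = 0 := by simp [Y2, pderiv_X]
  have d1 : pderiv (Sum.inr 1) (Y1 d) = 0 := by simp [Y1, pderiv_X]
  have d2 : pderiv (Sum.inr 1) (Y2 d) = 1 := by simp [Y2]
  have fac : ∀ i : ℕ, (1 : ℂ) / ((i + 1).factorial : ℂ) * ((i : ℂ) + 1) = 1 / (i.factorial : ℂ) := by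
    intro i
    have h1 : (i.factorial : ℂ) ≠ 0 := by exact_mod_cast i.factorial_ne_zero
    have h2 : (i : ℂ) + 1 ≠ 0 := by exact_mod_cast i.succ_ne_zero
    rw [Nat.factorial_succ]
    push_cast
    field_simp
  subst hF
  simp only [map_sum, Derivation.map_smul, Derivation.leibniz, Derivation.leibniz_pow, a1, a2, b1,
    b2, c1, c2, d1, d2, D1Y_rename, D2Y_rename, pd_rename, smul_zero, zero_add, add_zero,
    smul_eq_mul, mul_one, Finset.mul_sum]
  constructor
  · rw [Finset.sum_range_succ', Finset.sum_range_succ]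
    simp only [Function.iterate_zero, id, ha1, map_zero, mul_zero, smul_zero, add_zero, Nat.sub_self,
      zero_smul]
    refine Finset.sum_congr rfl fun i hi => ?_
    have hi : i < m := Finset.mem_range.mp hi
    rw [D1_iter d m a ha1 hH, ← fac i, map_smul]
    have e : m - i - 1 = m - (i + 1) := by omega
    have e' : ((m - i : ℕ) : MvPolynomial (Fin (d + 1) ⊕ Fin 2) ℂ) = C ((m : ℂ) - i) := by
      rw [← Nat.cast_sub hi.le]; simp
    simp only [e, nsmul_eq_mul, e', smul_eq_C_mul, map_mul]
    ring
  · rw [Finset.sum_range_succ, Finset.sum_range_succ']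
    simp only [← Function.iterate_succ_apply' (D2 d), Nat.succ_eq_add_one, ha3, map_zero, mul_zero,
      smul_zero, add_zero, zero_smul]
    refine Finset.sum_congr rfl fun i hi => ?_
    have hi : i < m := Finset.mem_range.mp hi
    have e : m - i = (m - (i + 1)) + 1 := by omega
    have e' : ((i + 1 : ℕ) : MvPolynomial (Fin (d + 1) ⊕ Fin 2) ℂ) = C ((i : ℂ) + 1) := by
      simp
    rw [← fac i, e]
    simp only [Nat.add_sub_cancel, nsmul_eq_mul, e', smul_eq_C_mul, map_mul, pow_succ]
    ring
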